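/- arXiv:2603.22071 — 4 statements merged into one kernel-verified Lean document; each statement's English description precedes it below -/
import Mathlib

section
/- Fix d ≥ 2 and let μ denote the surface (Lebesgue) measure on S^{d−1}. For every β ∈ [0,1) there exists a constant C_{d,β} > 0, depending only on d and β, such that for all α, α' ∈ S^{d−1} and all β' ∈ [0,1], one has ‖α − α'‖₂ + |β − β'| ≤ C_{d,β} · μ( A_{α,β} △ A_{α',β'} ). -/
open MeasureTheory
open scoped symmDiff RealInnerProductSpace

/-- The unit sphere `S^{d-1}` in `ℝ^d`. -/
abbrev Sph (d : ℕ) : Set (EuclideanSpace ℝ (Fin d)) :=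
  Metric.sphere (0 : EuclideanSpace ℝ (Fin d)) 1

/-- The spherical disc `A_{α,β} = {x ∈ S^{d-1} : ⟨x, α⟩ ≥ β}`. -/
def disc {d : ℕ} (α : Sph d) (β : ℝ) : Set (Sph d) :=
  {x : Sph d | β ≤ ⟪(x : EuclideanSpace ℝ (Fin d)), (α : EuclideanSpace ℝ (Fin d))⟫}

/-- The surface (Lebesgue) measure on the unit sphere `S^{d-1}`. -/
noncomputable def sphMeasure (d : ℕ) : Measure (Sph d) :=
  (volume : Measure (EuclideanSpace ℝ (Fin d))).toSphere

abbrev EE (d : ℕ) := EuclideanSpace ℝ (Fin d)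

def KK {d : ℕ} (α : EE d) (β : ℝ) : Set (EE d) :=
  {y | 0 < ‖y‖ ∧ ‖y‖ < 1 ∧ β * ‖y‖ ≤ ⟪y, α⟫}

theorem KK_meas {d : ℕ} (α : EE d) (β : ℝ) : MeasurableSet (KK α β) := by
  unfold KK
  have h1 : MeasurableSet {y : EE d | 0 < ‖y‖} := measurableSet_lt (by fun_prop) (by fun_prop)
  have h2 : MeasurableSet {y : EE d | ‖y‖ < 1} := measurableSet_lt (by fun_prop) (by fun_prop)
  have h3 : MeasurableSet {y : EE d | β * ‖y‖ ≤ ⟪y, α⟫} :=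
    measurableSet_le (by fun_prop) (by fun_prop)
  exact h1.inter (h2.inter h3)

theorem KK_sub {d : ℕ} (α : EE d) (β : ℝ) : KK α β ⊆ Metric.ball 0 1 := by
  intro y hy; simpa using hy.2.1

theorem KK_fin {d : ℕ} (α : EE d) (β : ℝ) : volume (KK α β) ≠ ⊤ :=
  ((measure_mono (KK_sub α β)).trans_lt measure_ball_lt_top).ne

theorem KK_anti {d : ℕ} (α : EE d) {a b : ℝ} (h : a ≤ b) : KK α b ⊆ KK α a := by
  intro y hy
  exact ⟨hy.1, hy.2.1, (mul_le_mul_of_nonneg_right h (norm_nonneg _)).trans hy.2.2⟩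

theorem KK_pre {d : ℕ} (R : EE d ≃ₗᵢ[ℝ] EE d) (α : EE d) (β : ℝ) :
    R ⁻¹' (KK (R α) β) = KK α β := by
  ext y; simp [KK, R.norm_map, R.inner_map_map]

theorem exists_R {d : ℕ} (α α' : EE d) (h : ‖α‖ = ‖α'‖) :
    ∃ R : EE d ≃ₗᵢ[ℝ] EE d, R α = α' := ⟨_, Submodule.reflection_sub h⟩

theorem KK_vol {d : ℕ} (α α' : EE d) (h : ‖α‖ = ‖α'‖) (β : ℝ) :
    volume.real (KK α β) = volume.real (KK α' β) := by
  obtain ⟨R, rfl⟩ := exists_R α α' h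
  rw [← KK_pre R α β]
  unfold Measure.real
  rw [R.measurePreserving.measure_preimage (KK_meas _ _).nullMeasurableSet]

theorem KK_int {d : ℕ} (R : EE d ≃ₗᵢ[ℝ] EE d) (α v : EE d) (β : ℝ) :
    ∫ y in KK α β, ⟪R y, v⟫ = ∫ y in KK (R α) β, ⟪y, v⟫ := by
  rw [← KK_pre R α β]
  exact R.measurePreserving.setIntegral_preimage_emb
    R.toHomeomorph.measurableEmbedding (fun y => ⟪y, v⟫) _

theorem KK_mom {d : ℕ} (α α' : EE d) (h : ‖α‖ = ‖α'‖) (β : ℝ) :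
    ∫ y in KK α β, ⟪y, α⟫ = ∫ y in KK α' β, ⟪y, α'⟫ := by
  obtain ⟨R, rfl⟩ := exists_R α α' h
  rw [← KK_int R α]
  simp [R.inner_map_map]

theorem KK_integrable {d : ℕ} (α v : EE d) (β : ℝ) :
    IntegrableOn (fun y => ⟪y, v⟫) (KK α β) := by
  have : IntegrableOn (fun y : EE d => ⟪y, v⟫) (Metric.closedBall 0 1) :=
    ContinuousOn.integrableOn_compact (isCompact_closedBall _ _) (by fun_prop)
  exact this.mono_set ((KK_sub α β).trans Metric.ball_subset_closedBall)

theorem KK_mom2 {d : ℕ} (α v : EE d) (h : ‖α‖ = 1) (β : ℝ) :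
    ∫ y in KK α β, ⟪y, v⟫ = ⟪α, v⟫ * ∫ y in KK α β, ⟪y, α⟫ := by
  have hR : (Submodule.reflection (ℝ ∙ α)) α = α := by
    rw [Submodule.reflection_eq_self_iff]; exact Submodule.mem_span_singleton_self α
  have h1 := KK_int (Submodule.reflection (ℝ ∙ α)) α v β
  rw [hR] at h1
  have h2 : ∀ y : EE d, ⟪(Submodule.reflection (ℝ ∙ α)) y, v⟫ = 2 * ⟪α, v⟫ * ⟪y, α⟫ - ⟪y, v⟫ := by
    intro y
    rw [Submodule.reflection_singleton_apply]
    simp [h, inner_sub_left, inner_smul_left, two_smul, inner_add_left, real_inner_comm α y]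
    ring
  simp_rw [h2] at h1
  rw [integral_sub ((KK_integrable α α β).const_mul _) (KK_integrable α v β),
    integral_const_mul] at h1
  linarith

theorem KK_mom_pos {d : ℕ} (α : EE d) (h : ‖α‖ = 1) (β : ℝ) (h0 : 0 ≤ β) (h1 : β < 1) :
    0 < ∫ y in KK α β, ⟪y, α⟫ := by
  rw [setIntegral_pos_iff_support_of_nonneg_ae _ (KK_integrable α α β)]
  · let U : Set (EE d) := {y | 0 < ‖y‖} ∩ ({y | ‖y‖ < 1} ∩ {y | β * ‖y‖ < ⟪y, α⟫})
    have hU : IsOpen U := by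
      refine (isOpen_lt (by fun_prop) (by fun_prop)).inter
        ((isOpen_lt (by fun_prop) (by fun_prop)).inter (isOpen_lt (by fun_prop) (by fun_prop)))
    have hne : U.Nonempty := by
      refine ⟨(1/2:ℝ) • α, ?_, ?_, ?_⟩
      · have : α ≠ 0 := by rintro rfl; simp at h
        simp [this]
      · simp [norm_smul, h]; norm_num
      · simp [norm_smul, h, inner_smul_left]; linarith
    refine (hU.measure_pos volume hne).trans_le (measure_mono ?_)
    rintro y ⟨ha, hb, hc⟩
    refine ⟨?_, ha, hb, le_of_lt hc⟩
    have : 0 ≤ β * ‖y‖ := by positivity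
    exact (this.trans_lt hc).ne'
  · refine (ae_restrict_iff' (KK_meas α β)).2 (Filter.Eventually.of_forall fun y hy => ?_)
    have : 0 ≤ β * ‖y‖ := by positivity
    exact this.trans hy.2.2

theorem KK_int_le {d : ℕ} (w : EE d) (S : Set (EE d)) (hS : S ⊆ Metric.ball 0 1) :
    |∫ y in S, ⟪y, w⟫| ≤ ‖w‖ * volume.real S := by
  have hfin : volume S < ⊤ := (measure_mono hS).trans_lt measure_ball_lt_top
  rw [← Real.norm_eq_abs]
  refine norm_setIntegral_le_of_norm_le_const (f := fun y : EE d => ⟪y, w⟫) hfin ?_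
  intro y hy
  have h1 : ‖y‖ < 1 := by simpa using hS hy
  calc ‖⟪y, w⟫‖ ≤ ‖y‖ * ‖w‖ := norm_inner_le_norm _ _
    _ ≤ 1 * ‖w‖ := by gcongr
    _ = ‖w‖ := one_mul _

theorem KK_dir {d : ℕ} (α α' : EE d) (h : ‖α‖ = 1) (h' : ‖α'‖ = 1) (β : ℝ) :
    (∫ y in KK α β, ⟪y, α⟫) * ‖α - α'‖ ≤ volume.real (KK α β ∆ KK α' β) := by
  set w := α - α' with hw
  set H := ∫ y in KK α β, ⟪y, α⟫ with hH
  rcases eq_or_ne w 0 with h0 | h0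
  · rw [h0, norm_zero, mul_zero]; exact measureReal_nonneg
  have e1 := KK_mom2 α w h β
  have e2 := KK_mom2 α' w h' β
  rw [← KK_mom α α' (h.trans h'.symm) β] at e2
  rw [← hH] at e1 e2
  have e3 : (∫ y in KK α β, ⟪y, w⟫) - ∫ y in KK α' β, ⟪y, w⟫ = H * ‖w‖^2 := by
    rw [e1, e2, ← sub_mul, ← inner_sub_left, ← hw, real_inner_self_eq_norm_sq, mul_comm]
  have f1 := integral_inter_add_sdiff (KK_meas α' β) (KK_integrable α w β)
  have f2 := integral_inter_add_sdiff (KK_meas α β) (KK_integrable α' w β)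
  rw [Set.inter_comm] at f2
  have g1 := KK_int_le w (KK α β \ KK α' β) (Set.sdiff_subset.trans (KK_sub _ _))
  have g2 := KK_int_le w (KK α' β \ KK α β) (Set.sdiff_subset.trans (KK_sub _ _))
  rw [measureReal_symmDiff_eq (KK_meas _ _) (KK_meas _ _) (KK_fin _ _) (KK_fin _ _)]
  have hp : 0 < ‖w‖ := norm_pos_iff.2 h0
  have := abs_le.1 g1
  have := abs_le.1 g2
  refine le_of_mul_le_mul_left ?_ hp
  nlinarith

theorem phi_lt {a b : ℝ} (ha : 0 ≤ a) (hab : a ≤ b) (hb : b < 1) :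
    b - a ≤ b / √(1 - b^2) - a / √(1 - a^2) := by
  have hb1 : 0 < 1 - b^2 := by nlinarith
  have ha1 : 0 < 1 - a^2 := by nlinarith
  have sb := Real.sqrt_pos.2 hb1
  have sa := Real.sqrt_pos.2 ha1
  have h1 : √(1 - b^2) ≤ √(1 - a^2) := Real.sqrt_le_sqrt (by nlinarith)
  have h2 : √(1 - a^2) ≤ 1 := by exact Real.sqrt_le_one.2 (by nlinarith)
  have h3 : b / √(1 - a^2) ≤ b / √(1 - b^2) :=
    div_le_div_of_nonneg_left (ha.trans hab) sb h1
  have h4 : b - a ≤ (b - a) / √(1 - a^2) := by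
    rw [le_div_iff₀ sa]; nlinarith
  rw [sub_div] at h4
  linarith

theorem shell_pt {a b c s N t : ℝ} (ha : 0 ≤ a) (hab : a ≤ b) (hbc : b ≤ c) (hc : c < 1)
    (hN : 0 < N) (hNr : N < √(1 - c^2)) (ht : 0 ≤ t) (hts : t^2 = s^2 + N^2)
    (h1 : a / √(1 - a^2) * N < s) (h2 : s < b / √(1 - b^2) * N) :
    0 < t ∧ t < 1 ∧ a * t ≤ s ∧ s < b * t := by
  have hb1 : 0 < 1 - b^2 := by nlinarith
  have ha1 : 0 < 1 - a^2 := by nlinarith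
  have hc1 : 0 < 1 - c^2 := by nlinarith
  have sb := Real.sqrt_pos.2 hb1
  have sa := Real.sqrt_pos.2 ha1
  have qb := Real.sq_sqrt hb1.le
  have qa := Real.sq_sqrt ha1.le
  have qc := Real.sq_sqrt hc1.le
  have hb0 : 0 ≤ b := ha.trans hab
  have hs : 0 < s := lt_of_le_of_lt (by positivity) h1
  rw [div_mul_eq_mul_div, div_lt_iff₀ sa] at h1
  rw [div_mul_eq_mul_div, lt_div_iff₀ sb] at h2
  have h1' : (a * N)^2 < (s * √(1 - a^2))^2 := pow_lt_pow_left₀ h1 (by positivity) (by norm_num)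
  have h2' : (s * √(1 - b^2))^2 < (b * N)^2 := pow_lt_pow_left₀ h2 (by positivity) (by norm_num)
  have h3' : N^2 < (√(1 - c^2))^2 := pow_lt_pow_left₀ hNr hN.le (by norm_num)
  rw [mul_pow, mul_pow, qa] at h1'
  rw [mul_pow, mul_pow, qb] at h2'
  rw [qc] at h3'
  refine ⟨by nlinarith [sq_pos_of_pos hN], ?_, ?_, ?_⟩
  · have hcb : b^2 ≤ c^2 := by gcongr
    have : t^2 * (1 - b^2) < 1 * (1 - b^2) := by nlinarith
    have := lt_of_mul_lt_mul_right this hb1.le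
    nlinarith
  · refine le_of_sq_le_sq ?_ hs.le
    rw [mul_pow, hts]; nlinarith
  · refine lt_of_pow_lt_pow_left₀ 2 (by positivity) ?_
    rw [mul_pow, hts]; nlinarith

theorem shell {n : ℕ} (hn : 1 ≤ n) (c : ℝ) (hc0 : 0 ≤ c) (hc : c < 1) :
    ∃ k : ℝ, 0 < k ∧ ∀ a b : ℝ, 0 ≤ a → a ≤ b → b ≤ c →
      k * (b - a) ≤ volume.real (KK (EuclideanSpace.single 0 1 : EE (n+1)) a)
        - volume.real (KK (EuclideanSpace.single 0 1 : EE (n+1)) b) := by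
  set e : EE (n+1) := EuclideanSpace.single 0 1 with he
  set r := √(1 - c^2) with hr
  have hr0 : 0 < r := Real.sqrt_pos.2 (by nlinarith)
  let A : Set (EE n) := {z | r / 2 < ‖z‖} ∩ {z | ‖z‖ < r}
  have hAo : IsOpen A := (isOpen_lt (by fun_prop) (by fun_prop)).inter
    (isOpen_lt (by fun_prop) (by fun_prop))
  have hAne : A.Nonempty := by
    refine ⟨EuclideanSpace.single ⟨0, hn⟩ (3/4*r), ?_, ?_⟩
    · simp [abs_of_pos hr0]; linarith
    · simp [abs_of_pos hr0]; linarith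
  have hApos : 0 < volume A := hAo.measure_pos volume hAne
  have hAfin : volume A ≠ ⊤ := by
    have h1 : A ⊆ Metric.ball 0 r := fun z hz => by simpa using hz.2
    exact ((measure_mono h1).trans_lt measure_ball_lt_top).ne
  let Z : Set (Fin n → ℝ) := WithLp.toLp 2 ⁻¹' A
  have hZ : volume Z = volume A :=
    (PiLp.volume_preserving_toLp (Fin n)).measure_preimage hAo.measurableSet.nullMeasurableSet
  have hZm : MeasurableSet Z :=
    (PiLp.volume_preserving_toLp (Fin n)).measurable hAo.measurableSet
  let N : (Fin n → ℝ) → ℝ := fun z => ‖WithLp.toLp 2 z‖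
  have hNm : Measurable N := (PiLp.volume_preserving_toLp (Fin n)).measurable.norm
  refine ⟨r / 2 * volume.real A, mul_pos (by positivity) (ENNReal.toReal_pos hApos.ne' hAfin), ?_⟩
  intro a b ha hab hbc
  have hsub : KK e b ⊆ KK e a := KK_anti e hab
  rw [← measureReal_sdiff hsub (KK_meas _ _) (KK_fin _ _)]
  let P : Set ((Fin n → ℝ) × ℝ) :=
    regionBetween (fun z => a / √(1 - a^2) * N z) (fun z => b / √(1 - b^2) * N z) Z
  have hPm : MeasurableSet P :=
    measurableSet_regionBetween (hNm.const_mul _) (hNm.const_mul _) hZm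
  have hPv : ENNReal.ofReal ((b - a) * (r / 2)) * volume A ≤ volume P := by
    rw [Measure.volume_eq_prod, volume_regionBetween_eq_lintegral' (hNm.const_mul _)
      (hNm.const_mul _) hZm, ← hZ, ← setLIntegral_const]
    refine setLIntegral_mono' hZm fun z hz => ENNReal.ofReal_le_ofReal ?_
    have h1 := phi_lt ha hab (hbc.trans_lt hc)
    have h2 : r / 2 < N z := hz.1
    simp only [Pi.sub_apply]
    rw [← sub_mul]
    gcongr
    linarith
  have mp : MeasurePreserving (fun y : EE (n+1) =>
      ((MeasurableEquiv.piFinSuccAbove (fun _ => ℝ) 0) (WithLp.ofLp y)).swap)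
      volume (volume : Measure ((Fin n → ℝ) × ℝ)) :=
    (Measure.measurePreserving_swap (μ := (volume : Measure ℝ))
      (ν := (volume : Measure (Fin n → ℝ)))).comp
      ((volume_preserving_piFinSuccAbove (fun _ : Fin (n+1) => ℝ) 0).comp
        (PiLp.volume_preserving_ofLp (Fin (n+1))))
  have hle : volume P ≤ volume (KK e a \ KK e b) := by
    rw [← mp.measure_preimage hPm.nullMeasurableSet]
    refine measure_mono ?_
    intro y hy
    obtain ⟨hz, h1, h2⟩ := hy
    set z : Fin n → ℝ := fun i => y i.succ with hzdef
    have hz' : r / 2 < N z ∧ N z < r := hz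
    have h1' : a / √(1 - a^2) * N z < y 0 := h1
    have h2' : y 0 < b / √(1 - b^2) * N z := h2
    have hnorm : ‖y‖^2 = (y 0)^2 + (N z)^2 := by
      simp only [N]
      rw [EuclideanSpace.norm_sq_eq, EuclideanSpace.norm_sq_eq, Fin.sum_univ_succ]
      simp [hzdef]
    have hin : ⟪y, e⟫ = y 0 := by
      simp [he, EuclideanSpace.inner_single_right]
    obtain ⟨k1, k2, k3, k4⟩ := shell_pt ha hab hbc hc (by linarith) hz'.2 (norm_nonneg y)
      hnorm h1' h2'
    refine ⟨⟨k1, k2, hin ▸ k3⟩, fun hb => ?_⟩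
    have := hb.2.2
    rw [hin] at this
    linarith
  have hfin : volume (KK e a \ KK e b) ≠ ⊤ := measure_ne_top_of_subset Set.sdiff_subset (KK_fin e a)
  have := ENNReal.toReal_mono hfin (hPv.trans hle)
  rw [ENNReal.toReal_mul, ENNReal.toReal_ofReal (mul_nonneg (by linarith) (by linarith))] at this
  change _ ≤ (volume (KK e a \ KK e b)).toReal
  refine le_trans (le_of_eq ?_) this
  unfold Measure.real
  ring

open scoped Pointwise in
theorem cone_eq {d : ℕ} (α α' : Sph d) (β β' : ℝ) :
    Set.Ioo (0:ℝ) 1 • ((↑) '' (disc α β ∆ disc α' β') : Set (EE d))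
      = KK (α : EE d) β ∆ KK (α' : EE d) β' := by
  have key : ∀ (γ : Sph d) (b : ℝ) (x : Sph d) (t : ℝ), 0 < t → t < 1 →
      (t • (x : EE d) ∈ KK (γ : EE d) b ↔ x ∈ disc γ b) := by
    intro γ b x t h0 h1
    have hx : ‖(x : EE d)‖ = 1 := by simp
    simp only [KK, disc, Set.mem_ofPred_eq, norm_smul, hx, Real.norm_eq_abs, abs_of_pos h0,
      mul_one, inner_smul_left, h0, h1, true_and]
    simp only [conj_trivial]
    rw [mul_comm b t, mul_le_mul_iff_right₀ h0]
  ext y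
  rw [Set.mem_smul]
  constructor
  · rintro ⟨t, ⟨h0, h1⟩, _, ⟨x, hx, rfl⟩, rfl⟩
    rw [Set.mem_symmDiff] at hx ⊢
    rwa [key _ _ _ _ h0 h1, key _ _ _ _ h0 h1]
  · intro hy
    have hn : 0 < ‖y‖ ∧ ‖y‖ < 1 := by
      rcases hy with hy | hy
      · exact ⟨hy.1.1, hy.1.2.1⟩
      · exact ⟨hy.1.1, hy.1.2.1⟩
    have hx : ‖y‖⁻¹ • y ∈ Metric.sphere (0 : EE d) 1 := by
      simp [norm_smul, hn.1.ne']
    have hxy : ‖y‖ • (‖y‖⁻¹ • y) = y := by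
      rw [smul_smul, mul_inv_cancel₀ hn.1.ne', one_smul]
    refine ⟨‖y‖, hn, _, ⟨⟨_, hx⟩, ?_, rfl⟩, hxy⟩
    rw [Set.mem_symmDiff] at hy ⊢
    have k1 := key α β ⟨_, hx⟩ ‖y‖ hn.1 hn.2
    have k2 := key α' β' ⟨_, hx⟩ ‖y‖ hn.1 hn.2
    simp only [hxy] at k1 k2
    rwa [k1, k2] at hy

theorem disc_meas {d : ℕ} (α : Sph d) (β : ℝ) : MeasurableSet (disc α β) :=
  measurableSet_le (by fun_prop) (by fun_prop)

theorem sph_eq {d : ℕ} (α α' : Sph d) (β β' : ℝ) :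
    (sphMeasure d (disc α β ∆ disc α' β')).toReal
      = d * volume.real (KK (α : EE d) β ∆ KK (α' : EE d) β') := by
  unfold sphMeasure
  rw [Measure.toSphere_apply' _ ((disc_meas α β).symmDiff (disc_meas α' β')), cone_eq]
  simp [Measure.real]

theorem KK_nest {d : ℕ} (α : EE d) (a b : ℝ) :
    volume.real (KK α a ∆ KK α b) = |volume.real (KK α a) - volume.real (KK α b)| := by
  wlog h : a ≤ b generalizing a b
  · rw [symmDiff_comm, abs_sub_comm]; exact this b a (le_of_not_ge h)
  have hs := KK_anti α h
  rw [measureReal_symmDiff_eq (KK_meas _ _) (KK_meas _ _) (KK_fin _ _) (KK_fin _ _),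
    Set.sdiff_eq_empty.2 hs, measureReal_empty, add_zero,
    measureReal_sdiff hs (KK_meas _ _) (KK_fin _ _), abs_of_nonneg]
  exact sub_nonneg.2 (measureReal_mono hs (KK_fin _ _))

/-- Lemma: the distance between the parameters of two spherical discs is controlled by the
surface measure of their symmetric difference, with a constant depending only on `d, β`. -/
theorem statement16 (d : ℕ) (hd : 2 ≤ d) (β : ℝ) (hβ : β ∈ Set.Ico (0 : ℝ) 1) :
    ∃ C : ℝ, 0 < C ∧
      ∀ (α α' : Sph d), ∀ β' ∈ Set.Icc (0 : ℝ) 1,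
        ‖(α : EuclideanSpace ℝ (Fin d)) - (α' : EuclideanSpace ℝ (Fin d))‖ + |β - β'| ≤
          C * (sphMeasure d (disc α β ∆ disc α' β')).toReal := by
  obtain ⟨n, rfl⟩ : ∃ n, d = n + 1 := ⟨d - 1, by omega⟩
  obtain ⟨hβ0, hβ1⟩ := hβ
  set e : EE (n+1) := EuclideanSpace.single 0 1 with he
  have hen : ‖e‖ = 1 := by simp [he]
  obtain ⟨k, hk, hshell⟩ := shell (n := n) (by omega) ((1 + β) / 2) (by linarith) (by linarith)
  rw [← he] at hshell
  set H := ∫ y in KK e β, ⟪y, e⟫ with hH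
  have hHpos : 0 < H := KK_mom_pos e hen β hβ0 hβ1
  set q := k * ((1 - β) / 2) with hq
  have hqpos : 0 < q := mul_pos hk (by linarith)
  refine ⟨2 / H + 1 / q, by positivity, ?_⟩
  intro α α' β' ⟨h0, h1⟩
  have hα : ‖(α : EE (n+1))‖ = 1 := by simp
  have hα' : ‖(α' : EE (n+1))‖ = 1 := by simp
  rw [sph_eq]
  set S := volume.real (KK (α : EE (n+1)) β ∆ KK (α' : EE (n+1)) β') with hS
  have hS0 : 0 ≤ S := measureReal_nonneg
  have hV : |volume.real (KK e β) - volume.real (KK e β')| ≤ S := by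
    rw [KK_vol e α (hen.trans hα.symm), KK_vol e α' (hen.trans hα'.symm)]
    exact abs_measureReal_sub_le_measureReal_symmDiff' (KK_meas _ _).nullMeasurableSet
      (KK_meas _ _).nullMeasurableSet (KK_fin _ _) (KK_fin _ _)
  have hdir : H * ‖(α : EE (n+1)) - α'‖ ≤ 2 * S := by
    have t1 := KK_dir (α : EE (n+1)) α' hα hα' β
    rw [KK_mom (α : EE (n+1)) e (hα.trans hen.symm), ← hH] at t1
    have t2 := measureReal_symmDiff_le (μ := volume) (s := KK (α : EE (n+1)) β)
      (t := KK (α' : EE (n+1)) β') (KK (α' : EE (n+1)) β) (KK_fin _ _) (KK_fin _ _)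
    rw [KK_nest, KK_vol (α' : EE (n+1)) e (hα'.trans hen.symm),
      KK_vol (α' : EE (n+1)) e (hα'.trans hen.symm), abs_sub_comm] at t2
    linarith
  have hbet : q * |β - β'| ≤ S := by
    refine le_trans ?_ hV
    have hqk : q ≤ k := by nlinarith
    rcases le_total β' β with h | h
    · have := hshell β' β h0 h (by linarith)
      rw [abs_of_nonneg (sub_nonneg.2 h)]
      rw [abs_sub_comm]
      exact (le_trans (mul_le_mul_of_nonneg_right hqk (by linarith)) this).trans (le_abs_self _)
    · rw [abs_sub_comm, abs_of_nonneg (sub_nonneg.2 h)]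
      refine le_trans ?_ (le_abs_self _)
      rcases le_total β' ((1 + β) / 2) with h2 | h2
      · have := hshell β β' hβ0 h h2
        exact le_trans (mul_le_mul_of_nonneg_right hqk (by linarith)) this
      · have h3 := hshell β ((1 + β) / 2) hβ0 (by linarith) le_rfl
        have h4 := measureReal_mono (μ := volume) (KK_anti e h2) (KK_fin _ _)
        have h5 : q * (β' - β) ≤ q * 1 := mul_le_mul_of_nonneg_left (by linarith) hqpos.le
        have h6 : k * ((1 + β) / 2 - β) = q := by rw [hq]; ring
        linarith
  have f1 : ‖(α : EE (n+1)) - α'‖ ≤ 2 / H * S := by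
    rw [div_mul_eq_mul_div, le_div_iff₀ hHpos]; linarith
  have f2 : |β - β'| ≤ 1 / q * S := by
    rw [div_mul_eq_mul_div, le_div_iff₀ hqpos]; linarith
  have f3 : S ≤ ((n + 1 : ℕ) : ℝ) * S := by
    have : (1:ℝ) ≤ ((n + 1 : ℕ) : ℝ) := by push_cast; linarith [Nat.cast_nonneg (α := ℝ) n]
    nlinarith
  have f4 : (2 / H + 1 / q) * S ≤ (2 / H + 1 / q) * (((n + 1 : ℕ) : ℝ) * S) :=
    mul_le_mul_of_nonneg_left f3 (by positivity)
  linarith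
end

section
/- Let X_1, …, X_n be fixed distinct design points in a set M, let R_1 ⊆ M with r := |R_1|_D, and let θ > 0. Suppose μ = (μ_1,…,μ_n) ∈ ℝ^n satisfies μ_i = θ if X_i ∈ R_1 and μ_i = 0 if X_i ∉ R_1. Then sqrt( min(r, n−r) / 2 ) · θ ≤ T_{R_1}(μ) ≤ sqrt( min(r, n−r) ) · θ, and moreover T_{R_1}(μ) ≥ T_A(μ) for every subset A ⊆ M. -/
open MeasureTheory ProbabilityTheory
open scoped symmDiff ENNReal NNReal

attribute [local instance] Classical.propDecidable

/-- Number of design points falling in `A`, i.e. `|A|_D`. -/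
noncomputable def cnt {M : Type*} {n : ℕ} (X : Fin n → M) (A : Set M) : ℕ :=
  (Finset.univ.filter fun i => X i ∈ A).card

/-- Sum of the entries of `Z` over indices whose design point lies in `A`. -/
noncomputable def sumIn {M : Type*} {n : ℕ} (X : Fin n → M) (A : Set M) (Z : Fin n → ℝ) : ℝ :=
  ∑ i ∈ Finset.univ.filter (fun i => X i ∈ A), Z i

/-- The CUSUM statistic `T_A(Z)`, with the convention that it is `0` when
`|A|_D = 0` or `|A^c|_D = 0`. -/
noncomputable def cusum {M : Type*} {n : ℕ} (X : Fin n → M) (A : Set M) (Z : Fin n → ℝ) : ℝ :=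
  if cnt X A = 0 ∨ cnt X Aᶜ = 0 then 0
  else Real.sqrt ((cnt X A : ℝ) * (cnt X Aᶜ : ℝ) / (n : ℝ)) *
    (sumIn X A Z / (cnt X A : ℝ) - sumIn X Aᶜ Z / (cnt X Aᶜ : ℝ))

/-- The in-sample loss `L_n(A, B) = (1/n) * min(|A △ B|_D, |A △ B^c|_D)`. -/
noncomputable def lossN {M : Type*} {n : ℕ} (X : Fin n → M) (A B : Set M) : ℝ :=
  (1 / (n : ℝ)) * min ((cnt X (A ∆ B) : ℝ)) ((cnt X (A ∆ Bᶜ) : ℝ))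

theorem h_cnt_compl {M : Type*} {n : ℕ} (X : Fin n → M) (A : Set M) :
    (cnt X A : ℝ) + cnt X Aᶜ = n := by
  have h := Finset.card_filter_add_card_filter_not (s := (Finset.univ : Finset (Fin n)))
    (fun i => X i ∈ A)
  simp only [Finset.card_univ, Fintype.card_fin] at h
  unfold cnt
  simp only [Set.mem_compl_iff]
  exact_mod_cast h

theorem h_sumIn {M : Type*} {n : ℕ} (X : Fin n → M) (R A : Set M) (θ : ℝ)
    (μ : Fin n → ℝ) (hμ : ∀ i, μ i = if X i ∈ R then θ else 0) :
    sumIn X A μ = θ * (cnt X (A ∩ R) : ℝ) := by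
  unfold sumIn cnt
  simp only [hμ, Set.mem_inter_iff]
  rw [← Finset.sum_filter, Finset.filter_filter, Finset.sum_const, nsmul_eq_mul, mul_comm]

theorem h_cnt_mono {M : Type*} {n : ℕ} (X : Fin n → M) {A B : Set M} (h : A ⊆ B) :
    (cnt X A : ℝ) ≤ cnt X B := by
  unfold cnt
  exact_mod_cast Finset.card_le_card (fun i hi => by
    simp only [Finset.mem_filter, Finset.mem_univ, true_and] at hi ⊢
    exact h hi)

theorem h_cnt_split {M : Type*} {n : ℕ} (X : Fin n → M) (A R : Set M) :
    (cnt X (A ∩ R) : ℝ) + cnt X (Aᶜ ∩ R) = cnt X R := by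
  have h := Finset.card_filter_add_card_filter_not
    (s := (Finset.univ.filter (fun i => X i ∈ R))) (fun i => X i ∈ A)
  rw [Finset.filter_filter, Finset.filter_filter] at h
  unfold cnt
  simp only [Set.mem_inter_iff, Set.mem_compl_iff]
  rw [← h]
  push_cast
  simp only [and_comm]

theorem h_cusum_self {M : Type*} {n : ℕ} (X : Fin n → M) (R : Set M) (θ : ℝ)
    (μ : Fin n → ℝ) (hμ : ∀ i, μ i = if X i ∈ R then θ else 0) :
    cusum X R μ = Real.sqrt ((cnt X R : ℝ) * (cnt X Rᶜ : ℝ) / (n : ℝ)) * θ := by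
  unfold cusum
  split_ifs with h
  · rcases h with h | h <;> simp [h]
  · push Not at h
    have h1 : (cnt X R : ℝ) ≠ 0 := by exact_mod_cast h.1
    rw [h_sumIn X R R θ μ hμ, h_sumIn X R Rᶜ θ μ hμ]
    have e : cnt X (Rᶜ ∩ R) = 0 := by simp [cnt]
    rw [e, Set.inter_self]
    field_simp
    simp

theorem h_cusum_le {M : Type*} {n : ℕ} (X : Fin n → M) (R A : Set M) (θ : ℝ) (hθ : 0 < θ)
    (μ : Fin n → ℝ) (hμ : ∀ i, μ i = if X i ∈ R then θ else 0) :
    cusum X A μ ≤ Real.sqrt ((cnt X R : ℝ) * (cnt X Rᶜ : ℝ) / (n : ℝ)) * θ := by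
  unfold cusum
  split_ifs with h
  · positivity
  · push Not at h
    have ha : (0 : ℝ) < cnt X A := by exact_mod_cast Nat.pos_of_ne_zero h.1
    have hb : (0 : ℝ) < cnt X Aᶜ := by exact_mod_cast Nat.pos_of_ne_zero h.2
    rw [h_sumIn X R A θ μ hμ, h_sumIn X R Aᶜ θ μ hμ]
    have e1 := h_cnt_split X A R
    have e2 := h_cnt_compl X A
    have e3 := h_cnt_compl X R
    have i1 := h_cnt_mono X (Set.inter_subset_left : A ∩ R ⊆ A)
    have k0 : (0 : ℝ) ≤ cnt X (A ∩ R) := by positivity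
    have l0 : (0 : ℝ) ≤ cnt X (Aᶜ ∩ R) := by positivity
    have s0 : (0 : ℝ) ≤ cnt X Rᶜ := by positivity
    generalize (cnt X (A ∩ R) : ℝ) = k at *
    generalize (cnt X (Aᶜ ∩ R) : ℝ) = l at *
    generalize (cnt X A : ℝ) = a at *
    generalize (cnt X Aᶜ : ℝ) = b at *
    generalize (cnt X R : ℝ) = r at *
    generalize (cnt X Rᶜ : ℝ) = s at *
    generalize (n : ℝ) = N at *
    have hN : 0 < N := by linarith
    have hD : θ * k / a - θ * l / b = ((k * b - l * a) / (a * b)) * θ := by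
      field_simp
    rw [hD, ← mul_assoc]
    apply mul_le_mul_of_nonneg_right _ hθ.le
    rcases le_total (k * b - l * a) 0 with hE | hE
    · exact le_trans (mul_nonpos_of_nonneg_of_nonpos (Real.sqrt_nonneg _)
        (div_nonpos_of_nonpos_of_nonneg hE (by positivity))) (Real.sqrt_nonneg _)
    · apply Real.le_sqrt_of_sq_le
      rw [mul_pow, Real.sq_sqrt (by positivity)]
      have j1 : k * b - l * a ≤ a * s := by
        have : a * s - (k * b - l * a) = (a - k) * N := by
          have : s = a + b - k - l := by linarith
          rw [← e2, this]; ring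
        nlinarith [mul_nonneg (sub_nonneg.2 i1) hN.le]
      have j2 : k * b - l * a ≤ r * b := by
        rw [← e1]; nlinarith [mul_nonneg l0 ha.le, mul_nonneg l0 hb.le]
      have j3 : (k * b - l * a) ^ 2 ≤ (a * s) * (r * b) := by
        rw [sq]; exact mul_le_mul j1 j2 hE (by positivity)
      have : a * b / N * ((k * b - l * a) / (a * b)) ^ 2
          = ((k * b - l * a) ^ 2 / (a * b)) / N := by
        field_simp
      rw [this]
      apply div_le_div_of_nonneg_right _ hN.le
      rw [div_le_iff₀ (by positivity)]
      linarith

/-- Lemma (signal CUSUM bounds): for a one-region signal of height `θ` on `R₁`,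
`√(min(r, n−r)/2)·θ ≤ T_{R₁}(μ) ≤ √(min(r, n−r))·θ`, and `T_{R₁}(μ) ≥ T_A(μ)` for every `A`. -/
theorem statement17 {M : Type*} {n : ℕ} (X : Fin n → M) (hX : Function.Injective X)
    (R₁ : Set M) (θ : ℝ) (hθ : 0 < θ)
    (μ : Fin n → ℝ) (hμ : ∀ i, μ i = if X i ∈ R₁ then θ else 0) :
    Real.sqrt (min ((cnt X R₁ : ℝ)) ((n : ℝ) - (cnt X R₁ : ℝ)) / 2) * θ ≤ cusum X R₁ μ ∧
    cusum X R₁ μ ≤ Real.sqrt (min ((cnt X R₁ : ℝ)) ((n : ℝ) - (cnt X R₁ : ℝ))) * θ ∧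
    ∀ A : Set M, cusum X A μ ≤ cusum X R₁ μ := by
  have e3 := h_cnt_compl X R₁
  have r0 : (0 : ℝ) ≤ cnt X R₁ := by positivity
  have s0 : (0 : ℝ) ≤ cnt X R₁ᶜ := by positivity
  rw [h_cusum_self X R₁ θ μ hμ]
  refine ⟨?_, ?_, fun A => h_cusum_le X R₁ A θ hθ μ hμ⟩
  all_goals
    rw [← e3, add_sub_cancel_left]
    generalize (cnt X R₁ : ℝ) = r at *
    generalize (cnt X R₁ᶜ : ℝ) = s at *
    apply mul_le_mul_of_nonneg_right _ hθ.le
    apply Real.sqrt_le_sqrt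
    rcases (add_nonneg r0 s0).eq_or_lt with h | h
    · have hr : r = 0 := by linarith
      have hs : s = 0 := by linarith
      simp [hr, hs]
  · rw [div_le_div_iff₀ (by norm_num) h]
    rcases le_total r s with h1 | h1
    · rw [min_eq_left h1]; nlinarith
    · rw [min_eq_right h1]; nlinarith
  · rw [div_le_iff₀ h]
    rcases le_total r s with h1 | h1
    · rw [min_eq_left h1]; nlinarith
    · rw [min_eq_right h1]; nlinarith
end

section
/- Let X_1, …, X_n be fixed distinct design points in a set M, let R_1, A ⊆ M with r := |R_1|_D and δ := min( |A △ R_1|_D, |A △ R_1^c|_D ), and let θ > 0. Suppose μ = (μ_1,…,μ_n) ∈ ℝ^n satisfies μ_i = θ if X_i ∈ R_1 and μ_i = 0 if X_i ∉ R_1. Then (θ²/2) · min(r, n−r, δ) ≤ RSS_A(μ) ≤ θ² · min(r, n−r, δ). -/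
open MeasureTheory ProbabilityTheory
open scoped symmDiff ENNReal NNReal

attribute [local instance] Classical.propDecidable

/-- The residual sum of squares `RSS_A(Z)`, where the within-cell means are taken
to be `0` when the corresponding cell contains no design points. -/
noncomputable def rss {M : Type*} {n : ℕ} (X : Fin n → M) (A : Set M) (Z : Fin n → ℝ) : ℝ :=
  (∑ i ∈ Finset.univ.filter (fun i => X i ∈ A),
      (Z i - sumIn X A Z / (cnt X A : ℝ)) ^ 2) +
  (∑ i ∈ Finset.univ.filter (fun i => X i ∈ Aᶜ),
      (Z i - sumIn X Aᶜ Z / (cnt X Aᶜ : ℝ)) ^ 2)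

theorem cell_bound {M : Type*} {n : ℕ} (X : Fin n → M) (R B : Set M) (θ : ℝ)
    (μ : Fin n → ℝ) (hμ : ∀ i, μ i = if X i ∈ R then θ else 0) :
    (∑ i ∈ Finset.univ.filter (fun i => X i ∈ B), (μ i - sumIn X B μ / (cnt X B : ℝ)) ^ 2)
      ≤ θ ^ 2 * cnt X (B ∩ R) ∧
    (∑ i ∈ Finset.univ.filter (fun i => X i ∈ B), (μ i - sumIn X B μ / (cnt X B : ℝ)) ^ 2)
      ≤ θ ^ 2 * cnt X (B ∩ Rᶜ) ∧
    (θ ^ 2 / 2 * cnt X (B ∩ R) ≤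
      (∑ i ∈ Finset.univ.filter (fun i => X i ∈ B), (μ i - sumIn X B μ / (cnt X B : ℝ)) ^ 2) ∨
     θ ^ 2 / 2 * cnt X (B ∩ Rᶜ) ≤
      (∑ i ∈ Finset.univ.filter (fun i => X i ∈ B), (μ i - sumIn X B μ / (cnt X B : ℝ)) ^ 2)) := by
  have key : ∀ f : ℝ → ℝ, ∑ i ∈ Finset.univ.filter (fun i => X i ∈ B), f (μ i)
      = cnt X (B ∩ R) * f θ + cnt X (B ∩ Rᶜ) * f 0 := by
    intro f
    rw [← Finset.sum_filter_add_sum_filter_not _ (fun i => X i ∈ R)]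
    congr 1
    · rw [Finset.sum_congr rfl (g := fun _ => f θ)]
      · simp [cnt, Finset.filter_filter]
      · intro i hi
        rw [hμ i, if_pos (Finset.mem_filter.1 hi).2]
    · rw [Finset.sum_congr rfl (g := fun _ => f 0)]
      · simp [cnt, Finset.filter_filter]
      · intro i hi
        rw [hμ i, if_neg (Finset.mem_filter.1 hi).2]
  have hs : sumIn X B μ = cnt X (B ∩ R) * θ := by
    have := key id
    simpa [sumIn] using this
  have hc : (cnt X B : ℝ) = cnt X (B ∩ R) + cnt X (B ∩ Rᶜ) := by
    have := key (fun _ => 1)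
    simpa [cnt] using this
  have hS := key (fun z => (z - sumIn X B μ / (cnt X B : ℝ)) ^ 2)
  rw [hS, hs, hc]
  have hp : (0 : ℝ) ≤ cnt X (B ∩ R) := Nat.cast_nonneg _
  have hq : (0 : ℝ) ≤ cnt X (B ∩ Rᶜ) := Nat.cast_nonneg _
  generalize (cnt X (B ∩ R) : ℝ) = p at *
  generalize (cnt X (B ∩ Rᶜ) : ℝ) = q at *
  rcases (add_nonneg hp hq).eq_or_lt with h | h
  · have : p = 0 := by linarith
    have : q = 0 := by linarith
    subst p q
    simp
  · have e : p * (θ - p * θ / (p + q)) ^ 2 + q * (0 - p * θ / (p + q)) ^ 2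
        = θ ^ 2 * (p * q / (p + q)) := by
      field_simp
      ring
    rw [e]
    have h1 : p * q / (p + q) ≤ p := by
      rw [div_le_iff₀ h]; nlinarith
    have h2 : p * q / (p + q) ≤ q := by
      rw [div_le_iff₀ h]; nlinarith
    refine ⟨by gcongr, by gcongr, ?_⟩
    rcases le_total p q with hh | hh
    · left
      have : p / 2 ≤ p * q / (p + q) := by
        rw [le_div_iff₀ h]; nlinarith
      nlinarith [mul_le_mul_of_nonneg_left this (sq_nonneg θ)]
    · right
      have : q / 2 ≤ p * q / (p + q) := by
        rw [le_div_iff₀ h]; nlinarith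
      nlinarith [mul_le_mul_of_nonneg_left this (sq_nonneg θ)]

theorem cnt_split {M : Type*} {n : ℕ} (X : Fin n → M) (C P Q : Set M)
    (h : C = P ∪ Q) (hd : Disjoint P Q) : (cnt X C : ℝ) = cnt X P + cnt X Q := by
  subst h
  unfold cnt
  rw [← Nat.cast_add, ← Finset.card_union_of_disjoint, ← Finset.filter_or]
  · congr 2
    ext i; simp
  · rw [Finset.disjoint_filter]
    intro i _ h1 h2
    exact Set.disjoint_left.1 hd h1 h2

/-- Lemma (signal RSS bounds): with `r = |R₁|_D` and `δ = min(|A △ R₁|_D, |A △ R₁^c|_D)`,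
`(θ²/2)·min(r, n−r, δ) ≤ RSS_A(μ) ≤ θ²·min(r, n−r, δ)`. -/
theorem statement18 {M : Type*} {n : ℕ} (X : Fin n → M) (hX : Function.Injective X)
    (R₁ A : Set M) (θ : ℝ) (hθ : 0 < θ)
    (μ : Fin n → ℝ) (hμ : ∀ i, μ i = if X i ∈ R₁ then θ else 0) :
    θ ^ 2 / 2 *
        min (min ((cnt X R₁ : ℝ)) ((n : ℝ) - (cnt X R₁ : ℝ)))
          (min ((cnt X (A ∆ R₁) : ℝ)) ((cnt X (A ∆ R₁ᶜ) : ℝ))) ≤ rss X A μ ∧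
    rss X A μ ≤ θ ^ 2 *
        min (min ((cnt X R₁ : ℝ)) ((n : ℝ) - (cnt X R₁ : ℝ)))
          (min ((cnt X (A ∆ R₁) : ℝ)) ((cnt X (A ∆ R₁ᶜ) : ℝ))) := by
  obtain ⟨u1, u2, u3⟩ := cell_bound X R₁ A θ μ hμ
  obtain ⟨v1, v2, v3⟩ := cell_bound X R₁ Aᶜ θ μ hμ
  have e1 : (cnt X R₁ : ℝ) = cnt X (A ∩ R₁) + cnt X (Aᶜ ∩ R₁) := by
    apply cnt_split
    · ext x; simp; tauto
    · rw [Set.disjoint_left]; intro x; simp; tauto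
  have e2 : (cnt X R₁ᶜ : ℝ) = cnt X (A ∩ R₁ᶜ) + cnt X (Aᶜ ∩ R₁ᶜ) := by
    apply cnt_split
    · ext x; simp; tauto
    · rw [Set.disjoint_left]; intro x; simp; tauto
  have e3 : (cnt X (A ∆ R₁) : ℝ) = cnt X (A ∩ R₁ᶜ) + cnt X (Aᶜ ∩ R₁) := by
    apply cnt_split
    · ext x; simp [Set.mem_symmDiff]; tauto
    · rw [Set.disjoint_left]; intro x; simp; tauto
  have e4 : (cnt X (A ∆ R₁ᶜ) : ℝ) = cnt X (A ∩ R₁) + cnt X (Aᶜ ∩ R₁ᶜ) := by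
    apply cnt_split
    · ext x; simp [Set.mem_symmDiff]; tauto
    · rw [Set.disjoint_left]; intro x; simp; tauto
  have e5 : (n : ℝ) = cnt X R₁ + cnt X R₁ᶜ := by
    have := cnt_split X Set.univ R₁ R₁ᶜ (by simp) disjoint_compl_right
    rw [← this]; simp [cnt]
  have e6 : (n : ℝ) - cnt X R₁ = cnt X (A ∩ R₁ᶜ) + cnt X (Aᶜ ∩ R₁ᶜ) := by linarith
  rw [e6, e1, e3, e4]
  have hr : ∃ S T : ℝ, S = _ ∧ T = _ ∧ rss X A μ = S + T := ⟨_, _, rfl, rfl, rfl⟩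
  obtain ⟨S, T, hS, hT, hr⟩ := hr
  rw [hr]
  have u1 : S ≤ θ ^ 2 * cnt X (A ∩ R₁) := by rw [hS]; convert u1
  have u2 : S ≤ θ ^ 2 * cnt X (A ∩ R₁ᶜ) := by rw [hS]; convert u2
  have u3 : θ ^ 2 / 2 * cnt X (A ∩ R₁) ≤ S ∨ θ ^ 2 / 2 * cnt X (A ∩ R₁ᶜ) ≤ S := by
    rw [hS]; convert u3
  have v1 : T ≤ θ ^ 2 * cnt X (Aᶜ ∩ R₁) := by rw [hT]; convert v1
  have v2 : T ≤ θ ^ 2 * cnt X (Aᶜ ∩ R₁ᶜ) := by rw [hT]; convert v2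
  have v3 : θ ^ 2 / 2 * cnt X (Aᶜ ∩ R₁) ≤ T ∨ θ ^ 2 / 2 * cnt X (Aᶜ ∩ R₁ᶜ) ≤ T := by
    rw [hT]; convert v3
  clear hS hT hr
  constructor
  · have hmono : ∀ x y : ℝ, x ≤ y → θ ^ 2 / 2 * x ≤ θ ^ 2 / 2 * y := fun x y h => by gcongr
    rcases u3 with u | u <;> rcases v3 with v | v
    · refine (hmono _ _ ((min_le_left _ _).trans (min_le_left _ _))).trans ?_
      linarith
    · refine (hmono _ _ ((min_le_right _ _).trans (min_le_right _ _))).trans ?_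
      linarith
    · refine (hmono _ _ ((min_le_right _ _).trans (min_le_left _ _))).trans ?_
      linarith
    · refine (hmono _ _ ((min_le_left _ _).trans (min_le_right _ _))).trans ?_
      linarith
  · have hp : 0 ≤ θ ^ 2 := sq_nonneg θ
    rw [mul_min_of_nonneg _ _ hp, mul_min_of_nonneg _ _ hp, mul_min_of_nonneg _ _ hp]
    refine le_min (le_min ?_ ?_) (le_min ?_ ?_) <;> linarith
end

section
/- Let X_1, …, X_n be fixed distinct design points in a set M, let R_1, A ⊆ M with r := |R_1|_D > 0 and δ := min( |A △ R_1|_D, |A △ R_1^c|_D ). Suppose μ = (μ_1,…,μ_n) ∈ ℝ^n satisfies μ_i = 0 whenever X_i ∉ R_1, and set θ_min := min_{i : X_i ∈ R_1} |μ_i| and θ_rms := ( (1/r) Σ_{i : X_i ∈ R_1} μ_i² )^{1/2}. Then T_A(μ) ≤ √r · θ_rms, and 2 · RSS_A(μ) ≥ min( θ_rms² · r, θ_min² · (n − r), θ_min² · δ ). -/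
open MeasureTheory ProbabilityTheory
open scoped symmDiff ENNReal NNReal

attribute [local instance] Classical.propDecidable

/-- Indices of design points in `A`. -/
noncomputable def idx {M : Type*} {n : ℕ} (X : Fin n → M) (A : Set M) : Finset (Fin n) :=
  Finset.univ.filter fun i => X i ∈ A

theorem mem_idx {M : Type*} {n : ℕ} (X : Fin n → M) (A : Set M) (i : Fin n) :
    i ∈ idx X A ↔ X i ∈ A := by simp [idx]

theorem filter_idx {M : Type*} {n : ℕ} (X : Fin n → M) (A : Set M)
    (inst : DecidablePred fun i => X i ∈ A) :
    @Finset.filter _ (fun i => X i ∈ A) inst Finset.univ = idx X A := by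
  ext i; simp [mem_idx]

theorem sets_aux {M : Type*} (A B : Set M) :
    A ∩ (A ∆ B) = A ∩ Bᶜ ∧ Aᶜ ∩ (A ∆ B) = Aᶜ ∩ B := by
  constructor
  · ext i; simp only [Set.mem_inter_iff, Set.mem_symmDiff, Set.mem_compl_iff]; tauto
  · ext i; simp only [Set.mem_inter_iff, Set.mem_symmDiff, Set.mem_compl_iff]; tauto

theorem cell_aux {ι : Type*} (s : Finset ι) (p : ι → Prop) (μ : ι → ℝ) (θ m : ℝ)
    (h0 : ∀ i, ¬ p i → μ i = 0) (h1 : ∀ i, p i → θ ^ 2 ≤ μ i ^ 2) (a b : ℝ)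
    (ha : a = ((s.filter p).card : ℝ)) (hb : b = ((s.filter (fun i => ¬ p i)).card : ℝ)) :
    (a ≤ b → ∑ i ∈ s, μ i ^ 2 ≤ 2 * ∑ i ∈ s, (μ i - m) ^ 2) ∧
    (a ≤ b → θ ^ 2 * a ≤ 2 * ∑ i ∈ s, (μ i - m) ^ 2) ∧
    (b ≤ a → θ ^ 2 * b ≤ 2 * ∑ i ∈ s, (μ i - m) ^ 2) := by
  have ha0 : 0 ≤ a := by rw [ha]; positivity
  have hb0 : 0 ≤ b := by rw [hb]; positivity
  have e1 : ∑ i ∈ s, (μ i - m) ^ 2 = ∑ i ∈ s.filter p, (μ i - m) ^ 2 + b * m ^ 2 := by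
    rw [← Finset.sum_filter_add_sum_filter_not s p]
    congr 1
    rw [hb, ← nsmul_eq_mul, ← Finset.sum_const]
    apply Finset.sum_congr rfl
    intro i hi
    rw [h0 i (Finset.mem_filter.1 hi).2]; ring
  have e2 : ∑ i ∈ s, μ i ^ 2 = ∑ i ∈ s.filter p, μ i ^ 2 := by
    rw [← Finset.sum_filter_add_sum_filter_not s p]
    rw [add_eq_left]
    apply Finset.sum_eq_zero
    intro i hi
    rw [h0 i (Finset.mem_filter.1 hi).2]; ring
  have e3 : ∑ i ∈ s.filter p, μ i ^ 2 ≤ 2 * (∑ i ∈ s.filter p, (μ i - m) ^ 2 + a * m ^ 2) := by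
    rw [ha, ← nsmul_eq_mul, ← Finset.sum_const, ← Finset.sum_add_distrib, Finset.mul_sum]
    apply Finset.sum_le_sum
    intro i _
    nlinarith [sq_nonneg (μ i - 2 * m)]
  have e4 : a * θ ^ 2 ≤ ∑ i ∈ s.filter p, μ i ^ 2 := by
    rw [ha, ← nsmul_eq_mul, ← Finset.sum_const]
    apply Finset.sum_le_sum
    intro i hi
    exact h1 i (Finset.mem_filter.1 hi).2
  have e5 : 0 ≤ ∑ i ∈ s.filter p, (μ i - m) ^ 2 := Finset.sum_nonneg fun i _ => sq_nonneg _
  rw [e1, e2]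
  generalize ∑ i ∈ s.filter p, (μ i - m) ^ 2 = P at *
  refine ⟨fun h => ?_, fun h => ?_, fun h => ?_⟩
  · nlinarith [mul_le_mul_of_nonneg_right h (sq_nonneg m)]
  · nlinarith [mul_le_mul_of_nonneg_right h (sq_nonneg m)]
  · rcases le_total (θ ^ 2) (2 * m ^ 2) with h' | h'
    · nlinarith [mul_le_mul_of_nonneg_right h' hb0]
    · nlinarith [mul_nonneg (sub_nonneg.2 h) (sub_nonneg.2 h')]

theorem cusum_aux (p q x y S T : ℝ) (hp : 0 < p) (hq : 0 < q) (hx : x ^ 2 ≤ p * S)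
    (hy : y ^ 2 ≤ q * T) :
    Real.sqrt (p * q / (p + q)) * (x / p - y / q) ≤ Real.sqrt (S + T) := by
  apply Real.le_sqrt_of_sq_le
  rw [mul_pow, Real.sq_sqrt (by positivity)]
  have h1 : x ^ 2 / p ≤ S := by rw [div_le_iff₀ hp]; linarith
  have h2 : y ^ 2 / q ≤ T := by rw [div_le_iff₀ hq]; linarith
  have h3 : p * q / (p + q) * (x / p - y / q) ^ 2
      = x ^ 2 / p + y ^ 2 / q - (x + y) ^ 2 / (p + q) := by
    field_simp; ring
  have h4 : 0 ≤ (x + y) ^ 2 / (p + q) := by positivity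
  linarith

/-- Lemma (general signal bounds): with `r = |R₁|_D > 0`,
`θ_min = min_{i : X_i ∈ R₁} |μ_i|`, `θ_rms = √((1/r) Σ_{i : X_i ∈ R₁} μ_i²)` and
`δ = min(|A △ R₁|_D, |A △ R₁^c|_D)`, one has `T_A(μ) ≤ √r · θ_rms` and
`2·RSS_A(μ) ≥ min(θ_rms²·r, θ_min²·(n−r), θ_min²·δ)`. -/
theorem statement19 {M : Type*} {n : ℕ} (X : Fin n → M) (hX : Function.Injective X)
    (R₁ A : Set M) (hr : 0 < cnt X R₁)
    (μ : Fin n → ℝ) (hμ : ∀ i, X i ∉ R₁ → μ i = 0)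
    (θmin θrms : ℝ)
    (hθmin : θmin = ⨅ i : {i : Fin n // X i ∈ R₁}, |μ i.1|)
    (hθrms : θrms = Real.sqrt
      ((∑ i ∈ Finset.univ.filter (fun i => X i ∈ R₁), μ i ^ 2) / (cnt X R₁ : ℝ))) :
    cusum X A μ ≤ Real.sqrt (cnt X R₁ : ℝ) * θrms ∧
    min (θrms ^ 2 * (cnt X R₁ : ℝ))
      (min (θmin ^ 2 * ((n : ℝ) - (cnt X R₁ : ℝ)))
        (θmin ^ 2 * min ((cnt X (A ∆ R₁) : ℝ)) ((cnt X (A ∆ R₁ᶜ) : ℝ)))) ≤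
      2 * rss X A μ := by
  have hr' : (0 : ℝ) < (cnt X R₁ : ℝ) := by exact_mod_cast hr
  have hθ : ∀ i, X i ∈ R₁ → θmin ^ 2 ≤ μ i ^ 2 := by
    intro i hi
    have h1 : θmin ≤ |μ i| := by
      rw [hθmin]
      exact ciInf_le (f := fun i : {i : Fin n // X i ∈ R₁} => |μ i.1|)
        (Set.finite_range _).bddBelow ⟨i, hi⟩
    have h0 : 0 ≤ θmin := by
      rw [hθmin]; exact Real.iInf_nonneg fun i => abs_nonneg _
    rw [← sq_abs (μ i)]
    exact pow_le_pow_left₀ h0 h1 2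
  rw [filter_idx] at hθrms
  have hAc : idx X Aᶜ = Finset.univ.filter (fun i => ¬ X i ∈ A) := by
    ext i; simp [mem_idx]
  have hS : ∑ i ∈ idx X R₁, μ i ^ 2
      = ∑ i ∈ idx X A, μ i ^ 2
        + ∑ i ∈ idx X Aᶜ, μ i ^ 2 := by
    rw [hAc, idx, idx, Finset.sum_filter_add_sum_filter_not]
    apply Finset.sum_subset (Finset.subset_univ _)
    intro i _ hi
    rw [hμ i (by simpa [mem_idx] using hi)]; ring
  have hn : (n : ℝ) = (cnt X A : ℝ) + (cnt X Aᶜ : ℝ) := by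
    change (n : ℝ) = ((idx X A).card : ℝ) + ((idx X Aᶜ).card : ℝ)
    rw [hAc, idx]
    have := Finset.card_filter_add_card_filter_not (s := (Finset.univ : Finset (Fin n))) (fun i => X i ∈ A)
    rw [Finset.card_univ, Fintype.card_fin] at this
    exact_mod_cast this.symm
  have hrms : θrms ^ 2 * (cnt X R₁ : ℝ) = ∑ i ∈ idx X R₁, μ i ^ 2 := by
    rw [hθrms, Real.sq_sqrt (div_nonneg (Finset.sum_nonneg fun i _ => sq_nonneg _) hr'.le)]
    field_simp
  have hrms0 : 0 ≤ θrms := by rw [hθrms]; exact Real.sqrt_nonneg _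
  constructor
  · unfold cusum
    split_ifs with h
    · positivity
    · push Not at h
      have h1 : Real.sqrt (cnt X R₁ : ℝ) * θrms = Real.sqrt
          (∑ i ∈ idx X A, μ i ^ 2
        + ∑ i ∈ idx X Aᶜ, μ i ^ 2) := by
        rw [← hS, ← hrms, Real.sqrt_mul (sq_nonneg _), Real.sqrt_sq hrms0, mul_comm]
      rw [h1, hn]
      apply cusum_aux
      · exact_mod_cast Nat.pos_of_ne_zero h.1
      · exact_mod_cast Nat.pos_of_ne_zero h.2
      · exact sq_sum_le_card_mul_sum_sq
      · exact sq_sum_le_card_mul_sum_sq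
  · obtain ⟨a1, a2, a3⟩ := cell_aux (idx X A) (fun i => X i ∈ R₁) μ θmin
      (sumIn X A μ / (cnt X A : ℝ)) hμ hθ _ _ rfl rfl
    obtain ⟨c1, c2, c3⟩ := cell_aux (idx X Aᶜ) (fun i => X i ∈ R₁) μ θmin
      (sumIn X Aᶜ μ / (cnt X Aᶜ : ℝ)) hμ hθ _ _ rfl rfl
    have hc : ∀ C : Set M, cnt X C = (idx X C).card := fun _ => rfl
    have split : ∀ B : Set M, (cnt X B : ℝ) = (cnt X (A ∩ B) : ℝ) + (cnt X (Aᶜ ∩ B) : ℝ) := by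
      intro B
      rw [hc, hc, hc]
      rw [← Finset.card_filter_add_card_filter_not (s := idx X B) (fun i => X i ∈ A)]
      push_cast
      congr 3
      · ext i; simp [mem_idx, and_comm]
      · ext i; simp [mem_idx, and_comm]
    have f1 : ∀ B C : Set M, ((idx X B).filter (fun i => X i ∈ C)).card = cnt X (B ∩ C) := by
      intro B C
      rw [hc]
      congr 1; ext i; simp [mem_idx]
    have f2 : ∀ B C : Set M, ((idx X B).filter (fun i => ¬ X i ∈ C)).card = cnt X (B ∩ Cᶜ) := by
      intro B C
      rw [hc]
      congr 1; ext i; simp [mem_idx]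
    simp only [f1, f2] at a1 a2 a3 c1 c2 c3
    have g1 : (cnt X (A ∆ R₁) : ℝ) = cnt X (A ∩ R₁ᶜ) + cnt X (Aᶜ ∩ R₁) := by
      rw [split (A ∆ R₁), (sets_aux A R₁).1, (sets_aux A R₁).2]
    have g2 : (cnt X (A ∆ R₁ᶜ) : ℝ) = cnt X (A ∩ R₁) + cnt X (Aᶜ ∩ R₁ᶜ) := by
      rw [split (A ∆ R₁ᶜ), (sets_aux A R₁ᶜ).1, (sets_aux A R₁ᶜ).2, compl_compl]
    have g3 : (n : ℝ) - (cnt X R₁ : ℝ) = cnt X (A ∩ R₁ᶜ) + cnt X (Aᶜ ∩ R₁ᶜ) := by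
      rw [← split R₁ᶜ]
      have hc : ∀ C, cnt X C = (idx X C).card := fun _ => rfl
      have hRc : idx X R₁ᶜ = Finset.univ.filter (fun i => ¬ X i ∈ R₁) := by
        ext i; simp [mem_idx]
      rw [hc, hc, hRc, idx]
      have := Finset.card_filter_add_card_filter_not (s := (Finset.univ : Finset (Fin n))) (fun i => X i ∈ R₁)
      rw [Finset.card_univ, Fintype.card_fin] at this
      rw [sub_eq_iff_eq_add']
      exact_mod_cast this.symm
    rw [hrms, hS, g1, g2, g3]
    unfold rss
    simp only [filter_idx]
    have ht := sq_nonneg θmin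
    rcases le_total (cnt X (A ∩ R₁) : ℝ) (cnt X (A ∩ R₁ᶜ) : ℝ) with h | h <;>
    rcases le_total (cnt X (Aᶜ ∩ R₁) : ℝ) (cnt X (Aᶜ ∩ R₁ᶜ) : ℝ) with h' | h'
    · refine (min_le_left _ _).trans ?_
      linarith [a1 h, c1 h']
    · refine ((min_le_right _ _).trans (min_le_right _ _)).trans
        ((mul_le_mul_of_nonneg_left (min_le_right _ _) ht).trans ?_)
      linarith [a2 h, c3 h']
    · refine ((min_le_right _ _).trans (min_le_right _ _)).trans
        ((mul_le_mul_of_nonneg_left (min_le_left _ _) ht).trans ?_)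
      linarith [a3 h, c2 h']
    · refine ((min_le_right _ _).trans (min_le_left _ _)).trans ?_
      linarith [a3 h, c3 h']
end
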